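/- Let k ≥ 2. Consider tuples (S₁,…,S_{2k}) of 2×2 complex matrices with Sᵢ ∈ U₊ for i odd and Sᵢ ∈ U₋ for i even. The map forgetting the first and last matrices, (S₁,…,S_{2k}) ↦ (S₂,…,S_{2k−1}), is a bijection from { (S₁,…,S_{2k}) : S_{2k}·S_{2k−1}⋯S₂·S₁ ∈ T } onto { (S₂,…,S_{2k−1}) : the (1,1) entry of S_{2k−1}⋯S₃·S₂ is nonzero }. -/

import Mathlib

/-- Upper unitriangular `2×2` complex matrices `[[1,*],[0,1]]`. -/
def Uplus : Set (Matrix (Fin 2) (Fin 2) ℂ) :=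
  {M | M 0 0 = 1 ∧ M 1 1 = 1 ∧ M 1 0 = 0}

/-- Lower unitriangular `2×2` complex matrices `[[1,0],[*,1]]`. -/
def Uminus : Set (Matrix (Fin 2) (Fin 2) ℂ) :=
  {M | M 0 0 = 1 ∧ M 1 1 = 1 ∧ M 0 1 = 0}

/-- Invertible diagonal `2×2` complex matrices. -/
def Tdiag : Set (Matrix (Fin 2) (Fin 2) ℂ) :=
  {M | M 0 1 = 0 ∧ M 1 0 = 0 ∧ M 0 0 ≠ 0 ∧ M 1 1 ≠ 0}

theorem aux_prod (n : ℕ) (S : Fin (n + 2) → Matrix (Fin 2) (Fin 2) ℂ) :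
    (List.ofFn (fun j : Fin (n + 2) => S j.rev)).prod =
      S (Fin.last (n + 1)) *
        (List.ofFn (fun j : Fin n => S (j.rev).succ.castSucc)).prod * S 0 := by
  rw [List.ofFn_succ, List.prod_cons, List.ofFn_succ', List.concat_eq_append, List.prod_append,
    List.prod_singleton, ← mul_assoc]
  simp only [Fin.rev_zero, Fin.rev_succ, Fin.rev_castSucc, Fin.rev_last, Fin.castSucc_zero,
    Fin.succ_castSucc]

theorem aux_det (n : ℕ) (S : Fin n → Matrix (Fin 2) (Fin 2) ℂ)
    (h : ∀ i, (S i).det = 1) :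
    (List.ofFn (fun j : Fin n => S j.rev)).prod.det = 1 := by
  have : ∀ l : List (Matrix (Fin 2) (Fin 2) ℂ), (∀ M ∈ l, M.det = 1) → l.prod.det = 1 := by
    intro l
    induction l with
    | nil => simp
    | cons a l ih =>
      intro hl
      rw [List.prod_cons, Matrix.det_mul, hl a (by simp), ih (fun M hM => hl M (by simp [hM])),
        one_mul]
  apply this
  intro M hM
  rw [List.mem_ofFn] at hM
  obtain ⟨j, rfl⟩ := hM
  exact h _

theorem aux_T (L P U : Matrix (Fin 2) (Fin 2) ℂ) (hL : L ∈ Uminus) (hU : U ∈ Uplus)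
    (hP : P.det = 1) :
    L * P * U ∈ Tdiag ↔
      P 0 0 ≠ 0 ∧ U 0 1 = -P 0 1 / P 0 0 ∧ L 1 0 = -P 1 0 / P 0 0 := by
  obtain ⟨l1, l2, l3⟩ := hL
  obtain ⟨u1, u2, u3⟩ := hU
  rw [Matrix.det_fin_two] at hP
  simp only [Tdiag, Set.mem_setOf_eq, Matrix.mul_apply, Fin.sum_univ_two, l1, l2, l3, u1, u2, u3]
  constructor
  · rintro ⟨h1, h2, h3, h4⟩
    have ha : P 0 0 ≠ 0 := by simpa using h3
    refine ⟨ha, ?_, ?_⟩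
    · rw [eq_div_iff ha]; linear_combination h1
    · rw [eq_div_iff ha]; linear_combination h2
  · rintro ⟨ha, h1, h2⟩
    rw [eq_div_iff ha] at h1 h2
    refine ⟨by linear_combination h1, by linear_combination h2, by simpa using ha, ?_⟩
    intro h
    have : (1 : ℂ) = 0 := by
      linear_combination P 0 0 * h - hP - (L 1 0 * P 0 0 + P 1 0) * h1 + P 0 1 * 0 * h2
    exact one_ne_zero this

theorem aux_ext_plus {A B : Matrix (Fin 2) (Fin 2) ℂ} (hA : A ∈ Uplus) (hB : B ∈ Uplus)
    (h : A 0 1 = B 0 1) : A = B := by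
  obtain ⟨a1, a2, a3⟩ := hA
  obtain ⟨b1, b2, b3⟩ := hB
  ext i j
  fin_cases i <;> fin_cases j <;> simp [*]

theorem aux_ext_minus {A B : Matrix (Fin 2) (Fin 2) ℂ} (hA : A ∈ Uminus) (hB : B ∈ Uminus)
    (h : A 1 0 = B 1 0) : A = B := by
  obtain ⟨a1, a2, a3⟩ := hA
  obtain ⟨b1, b2, b3⟩ := hB
  ext i j
  fin_cases i <;> fin_cases j <;> simp [*]

theorem aux_det_mid (n : ℕ) (S : Fin n → Matrix (Fin 2) (Fin 2) ℂ)
    (h : ∀ i : Fin n, if (i : ℕ) % 2 = 0 then S i ∈ Uminus else S i ∈ Uplus) (i : Fin n) :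
    (S i).det = 1 := by
  have := h i
  rw [Matrix.det_fin_two]
  split_ifs at this
  · obtain ⟨a, b, c⟩ := this
    simp [a, b, c]
  · obtain ⟨a, b, c⟩ := this
    simp [a, b, c]

theorem aux_main (n m : ℕ) (hm : m = n + 2) (hn : n % 2 = 0) (hi : ∀ i : Fin n, (i : ℕ) + 1 < m) :
    Set.BijOn
      (fun (S : Fin m → Matrix (Fin 2) (Fin 2) ℂ)
          (i : Fin n) => S ⟨(i : ℕ) + 1, hi i⟩)
      {S | (∀ i : Fin m,
              if (i : ℕ) % 2 = 0 then S i ∈ Uplus else S i ∈ Uminus) ∧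
           (List.ofFn (fun j : Fin m => S j.rev)).prod ∈ Tdiag}
      {S | (∀ i : Fin n,
              if (i : ℕ) % 2 = 0 then S i ∈ Uminus else S i ∈ Uplus) ∧
           (List.ofFn (fun j : Fin n => S j.rev)).prod 0 0 ≠ 0} := by
  subst hm
  have mid : ∀ S : Fin (n + 2) → Matrix (Fin 2) (Fin 2) ℂ,
      (∀ i : Fin (n + 2), if (i : ℕ) % 2 = 0 then S i ∈ Uplus else S i ∈ Uminus) →
      (∀ i : Fin n, if (i : ℕ) % 2 = 0 then S i.succ.castSucc ∈ Uminus
        else S i.succ.castSucc ∈ Uplus) := by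
    intro S h i
    have := h i.succ.castSucc
    simp only [Fin.val_castSucc, Fin.val_succ] at this
    split_ifs at this ⊢ <;> first | assumption | omega
  have first : ∀ S : Fin (n + 2) → Matrix (Fin 2) (Fin 2) ℂ,
      (∀ i : Fin (n + 2), if (i : ℕ) % 2 = 0 then S i ∈ Uplus else S i ∈ Uminus) →
      S 0 ∈ Uplus := by
    intro S h
    simpa using h 0
  have last : ∀ S : Fin (n + 2) → Matrix (Fin 2) (Fin 2) ℂ,
      (∀ i : Fin (n + 2), if (i : ℕ) % 2 = 0 then S i ∈ Uplus else S i ∈ Uminus) →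
      S (Fin.last (n + 1)) ∈ Uminus := by
    intro S h
    have := h (Fin.last (n + 1))
    rwa [if_neg (by simp only [Fin.val_last]; omega)] at this
  have key : ∀ S : Fin (n + 2) → Matrix (Fin 2) (Fin 2) ℂ,
      (∀ i : Fin (n + 2), if (i : ℕ) % 2 = 0 then S i ∈ Uplus else S i ∈ Uminus) →
      ∀ R : Fin n → Matrix (Fin 2) (Fin 2) ℂ, (∀ i, S i.succ.castSucc = R i) →
      ∀ P, P = (List.ofFn (fun j : Fin n => R j.rev)).prod →
      ((List.ofFn (fun j : Fin (n + 2) => S j.rev)).prod ∈ Tdiag ↔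
      P 0 0 ≠ 0 ∧ S 0 0 1 = -P 0 1 / P 0 0 ∧ S (Fin.last (n + 1)) 1 0 = -P 1 0 / P 0 0) := by
    intro S h R hR P hP
    rw [aux_prod]
    have hd := aux_det n _ (aux_det_mid n _ (mid S h))
    simp only [hR] at hd ⊢
    rw [← hP] at hd ⊢
    exact aux_T _ _ _ (last S h) (first S h) hd
  refine ⟨?_, ?_, ?_⟩
  · rintro S ⟨h, hT⟩
    exact ⟨mid S h, ((key S h _ (fun _ => rfl) _ rfl).1 hT).1⟩
  · rintro S ⟨h, hT⟩ S' ⟨h', hT'⟩ heq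
    have e : ∀ i : Fin n, S' i.succ.castSucc = S i.succ.castSucc :=
      fun i => (congrFun heq i).symm
    obtain ⟨-, a1, a2⟩ := (key S h _ (fun _ => rfl) _ rfl).1 hT
    obtain ⟨-, b1, b2⟩ := (key S' h' _ e _ rfl).1 hT'
    have e0 := aux_ext_plus (first S h) (first S' h') (a1.trans b1.symm)
    have e1 := aux_ext_minus (last S h) (last S' h') (a2.trans b2.symm)
    funext i
    induction i using Fin.lastCases with
    | last => exact e1
    | cast i =>
      induction i using Fin.cases with
      | zero => exact e0
      | succ i => exact (e i).symm
  · rintro R ⟨h, h0⟩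
    obtain ⟨P, hP⟩ : ∃ P, P = (List.ofFn (fun j : Fin n => R j.rev)).prod := ⟨_, rfl⟩
    rw [← hP] at h0
    let F : Fin (n + 1) → Matrix (Fin 2) (Fin 2) ℂ :=
      Fin.cons !![1, -P 0 1 / P 0 0; 0, 1] R
    let S : Fin (n + 2) → Matrix (Fin 2) (Fin 2) ℂ :=
      Fin.snoc F !![1, 0; -P 1 0 / P 0 0, 1]
    have S0 : S 0 = !![1, -P 0 1 / P 0 0; 0, 1] := by
      have : S (Fin.castSucc 0) = F 0 := Fin.snoc_castSucc (α := fun _ => _) _ _ _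
      exact this
    have Sl : S (Fin.last (n + 1)) = !![1, 0; -P 1 0 / P 0 0, 1] :=
      Fin.snoc_last (α := fun _ => _) _ _
    have Sm : ∀ i : Fin n, S i.succ.castSucc = R i := by
      intro i
      have : S (i.succ.castSucc) = F i.succ := Fin.snoc_castSucc (α := fun _ => _) _ _ _
      rw [this]
      rfl
    have hS : ∀ i : Fin (n + 2), if (i : ℕ) % 2 = 0 then S i ∈ Uplus else S i ∈ Uminus := by
      intro i
      induction i using Fin.lastCases with
      | last =>
        rw [if_neg (by simp only [Fin.val_last]; omega), Sl]
        simp [Uminus]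
      | cast i =>
        induction i using Fin.cases with
        | zero =>
          rw [if_pos (by simp), Fin.castSucc_zero, S0]
          simp [Uplus]
        | succ i =>
          have := h i
          rw [Sm]
          simp only [Fin.val_castSucc, Fin.val_succ]
          split_ifs at this ⊢ <;> first | assumption | omega
    refine ⟨S, ⟨hS, (key S hS R Sm P hP).2 ⟨h0, ?_, ?_⟩⟩, ?_⟩
    · rw [S0]; simp
    · rw [Sl]; simp
    · funext i
      exact Sm i

/-- forgetting the first and last matrices is a bijection from
`{(S₁,…,S_{2k}) : Sᵢ ∈ U₊ for i odd, Sᵢ ∈ U₋ for i even, S_{2k}⋯S₂S₁ ∈ T}`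
onto `{(S₂,…,S_{2k−1}) : (S_{2k−1}⋯S₃S₂)₁₁ ≠ 0}`.  (Here the first tuple is
`0`-based, `Sᵢ` corresponding to the index `i − 1`, and the second tuple is
indexed by `Fin (2k−2)`, `Sᵢ` corresponding to the index `i − 2`.) -/
theorem forget_first_and_last_bijOn (k : ℕ) (hk : 2 ≤ k) :
    Set.BijOn
      (fun (S : Fin (2 * k) → Matrix (Fin 2) (Fin 2) ℂ)
          (i : Fin (2 * k - 2)) => S ⟨(i : ℕ) + 1, by have := i.isLt; omega⟩)
      {S | (∀ i : Fin (2 * k),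
              if (i : ℕ) % 2 = 0 then S i ∈ Uplus else S i ∈ Uminus) ∧
           (List.ofFn (fun j : Fin (2 * k) => S j.rev)).prod ∈ Tdiag}
      {S | (∀ i : Fin (2 * k - 2),
              if (i : ℕ) % 2 = 0 then S i ∈ Uminus else S i ∈ Uplus) ∧
           (List.ofFn (fun j : Fin (2 * k - 2) => S j.rev)).prod 0 0 ≠ 0} := by
  exact aux_main (2 * k - 2) (2 * k) (by omega) (by omega) _
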